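/- The transformation τ_m is ergodic with respect to the invariant probability measure γ_m: it is measure-preserving for γ_m, and every Borel set A ⊆ [0,1] with τ_m⁻¹(A) = A satisfies γ_m(A) = 0 or γ_m(A) = 1. -/

import Mathlib

open MeasureTheory Set

/-- The Chan transformation `τ_m : [0,1] → [0,1]`: `τ_m(0) = 0` and, for
`x ∈ (m^{-(i+1)}, m^{-i}]` (equivalently `i = ⌊-log_m x⌋`),
`τ_m(x) = (1/(m-1)) (1/(mⁱ x) - 1)`. -/
noncomputable def chanTau (m : ℕ) (x : ℝ) : ℝ :=
  if x = 0 then 0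
  else (1 / ((m : ℝ) - 1)) * (1 / ((m : ℝ) ^ ⌊-Real.logb m x⌋ * x) - 1)

/-- The normalizing constant `k_m = (m-1)^2 / log(m^2/(2m-1))`. -/
noncomputable def chanK (m : ℕ) : ℝ :=
  ((m : ℝ) - 1) ^ 2 / Real.log ((m : ℝ) ^ 2 / (2 * (m : ℝ) - 1))

/-- The density `ρ_m(x) = k_m / (((m-1)x+1)((m-1)x+m))`. -/
noncomputable def chanRho (m : ℕ) (x : ℝ) : ℝ :=
  chanK m / ((((m : ℝ) - 1) * x + 1) * (((m : ℝ) - 1) * x + (m : ℝ)))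

/-- The measure `γ_m` on `[0,1]` with density `ρ_m` w.r.t. Lebesgue measure. -/
noncomputable def chanGamma (m : ℕ) : Measure ℝ :=
  (volume.restrict (Set.Icc (0 : ℝ) 1)).withDensity fun x => ENNReal.ofReal (chanRho m x)


theorem measurable_chanTau (m : ℕ) : Measurable (chanTau m) := by
  have h : Measurable fun x : ℝ => (m : ℝ) ^ ⌊-Real.logb m x⌋ :=
    (measurable_of_countable fun n : ℤ => (m : ℝ) ^ n).comp
      (Int.measurable_floor.comp (Real.measurable_log.div_const _).neg)
  exact Measurable.ite (measurableSet_singleton 0) measurable_const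
    (measurable_const.mul ((measurable_const.div (h.mul measurable_id)).sub_const 1))

/-- The inverse branch of `τ_m` onto `(m^{-(i+1)}, m^{-i}]`. -/
noncomputable def chanBranch (m i : ℕ) (y : ℝ) : ℝ :=
  ((m : ℝ) ^ i)⁻¹ / (1 + ((m : ℝ) - 1) * y)

theorem two_le_cast {m : ℕ} (hm : 2 ≤ m) : (2 : ℝ) ≤ m := by exact_mod_cast hm

theorem chanBranch_mem_Ioc {m : ℕ} (hm : 2 ≤ m) (i : ℕ) {y : ℝ} (hy : y ∈ Ico (0 : ℝ) 1) :
    chanBranch m i y ∈ Ioc (0 : ℝ) 1 := by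
  have h2 := two_le_cast hm
  have hd : 1 ≤ 1 + ((m : ℝ) - 1) * y := by nlinarith [hy.1]
  have hp : (1 : ℝ) ≤ (m : ℝ) ^ i := one_le_pow₀ (by linarith)
  refine ⟨by unfold chanBranch; positivity, ?_⟩
  exact div_le_one_of_le₀ ((inv_le_one_of_one_le₀ hp).trans hd) (by positivity)

theorem chanBranch_mem_Ioo {m : ℕ} (hm : 2 ≤ m) (i : ℕ) {y : ℝ} (hy : y ∈ Ioo (0 : ℝ) 1) :
    chanBranch m i y ∈ Ioo (0 : ℝ) 1 := by
  have h2 := two_le_cast hm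
  have hd : 1 < 1 + ((m : ℝ) - 1) * y := by nlinarith [hy.1]
  have hp : (1 : ℝ) ≤ (m : ℝ) ^ i := one_le_pow₀ (by linarith)
  refine ⟨by unfold chanBranch; positivity, ?_⟩
  exact (div_lt_one (by positivity)).2 ((inv_le_one_of_one_le₀ hp).trans_lt hd)

theorem floor_neg_logb_chanBranch {m : ℕ} (hm : 2 ≤ m) (i : ℕ) {y : ℝ} (hy : y ∈ Ico (0 : ℝ) 1) :
    ⌊-Real.logb m (chanBranch m i y)⌋ = (i : ℤ) := by
  have h2 := two_le_cast hm
  have hd : 1 ≤ 1 + ((m : ℝ) - 1) * y := by nlinarith [hy.1]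
  have hd' : 1 + ((m : ℝ) - 1) * y < m := by nlinarith [hy.2]
  have hlog : -Real.logb m (chanBranch m i y) = i + Real.logb m (1 + ((m : ℝ) - 1) * y) := by
    unfold chanBranch
    rw [Real.logb_div (by positivity) (by positivity), Real.logb_inv, Real.logb_pow,
      Real.logb_self_eq_one (by linarith)]
    ring
  rw [hlog, Int.floor_eq_iff]
  have h0 := Real.logb_nonneg (b := m) (by linarith) hd
  have h1 : Real.logb m (1 + ((m : ℝ) - 1) * y) < 1 := by
    rw [Real.logb_lt_iff_lt_rpow (by linarith) (by linarith), Real.rpow_one]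
    exact hd'
  push_cast
  constructor <;> linarith

theorem chanTau_chanBranch {m : ℕ} (hm : 2 ≤ m) (i : ℕ) {y : ℝ} (hy : y ∈ Ico (0 : ℝ) 1) :
    chanTau m (chanBranch m i y) = y := by
  have h2 := two_le_cast hm
  have hd : 1 ≤ 1 + ((m : ℝ) - 1) * y := by nlinarith [hy.1]
  have hm1 : (m : ℝ) - 1 ≠ 0 := by linarith
  rw [chanTau, if_neg (chanBranch_mem_Ioc hm i hy).1.ne', floor_neg_logb_chanBranch hm i hy,
    zpow_natCast, chanBranch]
  field_simp
  ring

theorem exists_chanBranch_chanTau {m : ℕ} (hm : 2 ≤ m) {x : ℝ} (hx : x ∈ Ioc (0 : ℝ) 1) :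
    chanTau m x ∈ Ico (0 : ℝ) 1 ∧ ∃ i, chanBranch m i (chanTau m x) = x := by
  have h2 := two_le_cast hm
  have hx0 := hx.1
  have hlog : 0 ≤ -Real.logb m x :=
    neg_nonneg.2 (Real.logb_nonpos (by linarith) hx.1.le hx.2)
  obtain ⟨i, hi⟩ := Int.eq_ofNat_of_zero_le (Int.floor_nonneg.2 hlog)
  have hm1 : 0 < (m : ℝ) - 1 := by linarith
  have hp : 0 < (m : ℝ) ^ i := by positivity
  have hτ : chanTau m x = 1 / ((m : ℝ) - 1) * (1 / ((m : ℝ) ^ i * x) - 1) := by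
    rw [chanTau, if_neg hx0.ne', hi, zpow_natCast]
  obtain ⟨h1, h3⟩ := Int.floor_eq_iff.1 hi
  push_cast at h1 h3
  have hxi : (m : ℝ) ^ i * x ≤ 1 := by
    have : Real.logb m ((m : ℝ) ^ i * x) ≤ 0 := by
      rw [Real.logb_mul (by positivity) hx0.ne', Real.logb_pow,
        Real.logb_self_eq_one (by linarith)]
      linarith
    rwa [Real.logb_nonpos_iff (by linarith) (by positivity)] at this
  have hxi' : 1 / m < (m : ℝ) ^ i * x := by
    have : -1 < Real.logb m ((m : ℝ) ^ i * x) := by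
      rw [Real.logb_mul (by positivity) hx0.ne', Real.logb_pow,
        Real.logb_self_eq_one (by linarith)]
      linarith
    rw [Real.lt_logb_iff_rpow_lt (by linarith) (by positivity), Real.rpow_neg_one] at this
    rwa [one_div]
  refine ⟨⟨?_, ?_⟩, i, ?_⟩
  · rw [hτ]
    have : 1 ≤ 1 / ((m : ℝ) ^ i * x) := (one_le_div (by positivity)).2 hxi
    exact mul_nonneg (by positivity) (by linarith)
  · rw [hτ, one_div_mul_eq_div, div_lt_one hm1]
    have : 1 / ((m : ℝ) ^ i * x) < m := by
      rw [div_lt_iff₀ (by positivity)] at hxi' ⊢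
      linarith
    linarith
  · rw [chanBranch, hτ]
    field_simp
    ring

theorem hasDerivAt_chanBranch {m : ℕ} (hm : 2 ≤ m) (i : ℕ) {y : ℝ} (hy : 0 ≤ y) :
    HasDerivAt (chanBranch m i)
      (-(((m : ℝ) ^ i)⁻¹ * ((m : ℝ) - 1) / (1 + ((m : ℝ) - 1) * y) ^ 2)) y := by
  have h2 := two_le_cast hm
  have hd : 0 < 1 + ((m : ℝ) - 1) * y := by nlinarith
  have := (((hasDerivAt_id y).const_mul ((m : ℝ) - 1)).const_add 1).inv hd.ne'
  refine (this.const_mul (((m : ℝ) ^ i)⁻¹)).congr_deriv ?_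
  simp only [id]
  ring

theorem injOn_chanBranch {m : ℕ} (hm : 2 ≤ m) (i : ℕ) :
    InjOn (chanBranch m i) (Ico 0 1) := fun x hx y hy h => by
  rw [← chanTau_chanBranch hm i hx, h, chanTau_chanBranch hm i hy]

theorem chanTau_preimage_inter_Ioc {m : ℕ} (hm : 2 ≤ m) (B : Set ℝ) :
    chanTau m ⁻¹' B ∩ Ioc 0 1 = ⋃ i, chanBranch m i '' (B ∩ Ico 0 1) := by
  ext x
  simp only [mem_inter_iff, mem_preimage, mem_iUnion, mem_image]
  constructor
  · rintro ⟨hB, hx⟩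
    obtain ⟨h, i, hi⟩ := exists_chanBranch_chanTau hm hx
    exact ⟨i, _, ⟨hB, h⟩, hi⟩
  · rintro ⟨i, y, ⟨hB, hy⟩, rfl⟩
    rw [chanTau_chanBranch hm i hy]
    exact ⟨hB, chanBranch_mem_Ioc hm i hy⟩

theorem pairwise_disjoint_chanBranch_image {m : ℕ} (hm : 2 ≤ m) (B : Set ℝ) :
    Pairwise (Function.onFun Disjoint fun i => chanBranch m i '' (B ∩ Ico 0 1)) := by
  intro i j hij
  refine disjoint_left.2 ?_
  rintro _ ⟨y, hy, rfl⟩ ⟨z, hz, h⟩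
  apply hij
  have h1 := floor_neg_logb_chanBranch hm i hy.2
  rw [← h, floor_neg_logb_chanBranch hm j hz.2] at h1
  exact_mod_cast h1.symm

theorem chanK_pos {m : ℕ} (hm : 2 ≤ m) : 0 < chanK m := by
  have h2 := two_le_cast hm
  refine div_pos (by nlinarith) (Real.log_pos ?_)
  rw [one_lt_div (by linarith)]
  nlinarith

theorem chanRho_pos {m : ℕ} (hm : 2 ≤ m) {x : ℝ} (hx : 0 ≤ x) : 0 < chanRho m x := by
  have h2 := two_le_cast hm
  have := chanK_pos hm
  have : 0 ≤ ((m : ℝ) - 1) * x := mul_nonneg (by linarith) hx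
  unfold chanRho
  positivity

/-- The density `ρ_m` is a fixed point of the transfer operator of `τ_m`. -/
theorem hasSum_chanRho_chanBranch {m : ℕ} (hm : 2 ≤ m) {y : ℝ} (hy : 0 ≤ y) :
    HasSum (fun i => |-(((m : ℝ) ^ i)⁻¹ * ((m : ℝ) - 1) / (1 + ((m : ℝ) - 1) * y) ^ 2)| *
      chanRho m (chanBranch m i y)) (chanRho m y) := by
  have h2 := two_le_cast hm
  have hm1 : 0 < (m : ℝ) - 1 := by linarith
  have hk := chanK_pos hm
  obtain ⟨u, hu⟩ : ∃ u, u = 1 + ((m : ℝ) - 1) * y := ⟨_, rfl⟩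
  have hu1 : 0 < u := by rw [hu]; positivity
  let F : ℕ → ℝ := fun i => chanK m / ((m : ℝ) - 1) * (1 / (((m : ℝ) - 1) * ((m : ℝ) ^ i)⁻¹ + u))
  have hterm : ∀ i, |-(((m : ℝ) ^ i)⁻¹ * ((m : ℝ) - 1) / (1 + ((m : ℝ) - 1) * y) ^ 2)| *
      chanRho m (chanBranch m i y) = F (i + 1) - F i := by
    intro i
    rw [abs_neg, abs_of_nonneg (by positivity), chanRho, chanBranch, ← hu]
    simp only [F, pow_succ]
    have hp : 0 < (m : ℝ) ^ i := by positivity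
    generalize (m : ℝ) ^ i = p at hp
    have h3 : 0 < ((m : ℝ) - 1) + p * u := by positivity
    have h4 : 0 < ((m : ℝ) - 1) + p * m * u := by positivity
    have e1 : ((m : ℝ) - 1) * (p⁻¹ / u) + 1 = (((m : ℝ) - 1) + p * u) / (p * u) := by field_simp
    have e2 : ((m : ℝ) - 1) * (p⁻¹ / u) + m = (((m : ℝ) - 1) + p * m * u) / (p * u) := by
      field_simp
    have e3 : ((m : ℝ) - 1) * p⁻¹ + u = (((m : ℝ) - 1) + p * u) / p := by field_simp
    have e4 : ((m : ℝ) - 1) * (p * m)⁻¹ + u = (((m : ℝ) - 1) + p * m * u) / (p * m) := by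
      field_simp
    rw [e1, e2, e3, e4]
    field_simp
    ring
  have hlim : Filter.Tendsto F Filter.atTop (nhds (chanK m / ((m : ℝ) - 1) * (1 / u))) := by
    have h0 : Filter.Tendsto (fun i : ℕ => ((m : ℝ) ^ i)⁻¹) Filter.atTop (nhds 0) :=
      (tendsto_pow_atTop_atTop_of_one_lt (by linarith)).inv_tendsto_atTop
    have := ((h0.const_mul ((m : ℝ) - 1)).add_const u)
    rw [mul_zero, zero_add] at this
    exact (tendsto_const_nhds.div this hu1.ne').const_mul _
  simp only [hterm]
  rw [hasSum_iff_tendsto_nat_of_nonneg]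
  · simp only [Finset.sum_range_sub]
    convert hlim.sub_const (F 0) using 2
    simp only [F, chanRho, pow_zero, inv_one, mul_one]
    have e1 : ((m : ℝ) - 1) * y + 1 = u := by rw [hu]; ring
    have e2 : ((m : ℝ) - 1) * y + m = (m - 1) + u := by rw [hu]; ring
    rw [e1, e2]
    have : 0 < (m : ℝ) - 1 + u := by positivity
    field_simp
    ring
  · intro i
    rw [← hterm i]
    exact mul_nonneg (abs_nonneg _) (chanRho_pos hm (by unfold chanBranch; rw [← hu]; positivity)).le

theorem measurable_chanRho {m : ℕ} : Measurable (chanRho m) := by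
  unfold chanRho
  fun_prop

theorem chanGamma_apply {m : ℕ} {B : Set ℝ} (hB : MeasurableSet B) :
    chanGamma m B = ∫⁻ x in B ∩ Ico 0 1, ENNReal.ofReal (chanRho m x) := by
  rw [chanGamma, withDensity_apply _ hB, Measure.restrict_congr_set Ico_ae_eq_Icc.symm,
    Measure.restrict_restrict hB]

theorem chanGamma_apply_Ioc {m : ℕ} {B : Set ℝ} (hB : MeasurableSet B) :
    chanGamma m B = ∫⁻ x in B ∩ Ioc 0 1, ENNReal.ofReal (chanRho m x) := by
  rw [chanGamma, withDensity_apply _ hB, Measure.restrict_congr_set Ioc_ae_eq_Icc.symm,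
    Measure.restrict_restrict hB]

theorem measurePreserving_chanTau {m : ℕ} (hm : 2 ≤ m) :
    MeasurePreserving (chanTau m) (chanGamma m) (chanGamma m) := by
  refine ⟨measurable_chanTau m, Measure.ext fun B hB => ?_⟩
  have hBI : MeasurableSet (B ∩ Ico (0 : ℝ) 1) := hB.inter measurableSet_Ico
  have hderiv : ∀ i, ∀ x ∈ B ∩ Ico (0 : ℝ) 1, HasDerivWithinAt (chanBranch m i)
      (-(((m : ℝ) ^ i)⁻¹ * ((m : ℝ) - 1) / (1 + ((m : ℝ) - 1) * x) ^ 2)) (B ∩ Ico 0 1) x :=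
    fun i x hx => (hasDerivAt_chanBranch hm i hx.2.1).hasDerivWithinAt
  have hinj : ∀ i, InjOn (chanBranch m i) (B ∩ Ico 0 1) :=
    fun i => (injOn_chanBranch hm i).mono inter_subset_right
  have hmeas : ∀ i, MeasurableSet (chanBranch m i '' (B ∩ Ico 0 1)) := fun i =>
    hBI.image_of_continuousOn_injOn (fun x hx => (hderiv i x hx).continuousWithinAt) (hinj i)
  rw [Measure.map_apply (measurable_chanTau m) hB,
    chanGamma_apply_Ioc (measurable_chanTau m hB), chanTau_preimage_inter_Ioc hm,
    lintegral_iUnion hmeas (pairwise_disjoint_chanBranch_image hm B)]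
  simp_rw [fun i => lintegral_image_eq_lintegral_abs_deriv_mul hBI (hderiv i) (hinj i)
    (fun x => ENNReal.ofReal (chanRho m x))]
  rw [← lintegral_tsum, chanGamma_apply hB]
  · refine setLIntegral_congr_fun hBI fun y hy => ?_
    have hsum := hasSum_chanRho_chanBranch hm hy.2.1
    simp_rw [← ENNReal.ofReal_mul (abs_nonneg _)]
    rw [← ENNReal.ofReal_tsum_of_nonneg _ hsum.summable, hsum.tsum_eq]
    intro i
    exact mul_nonneg (abs_nonneg _) (chanRho_pos hm (chanBranch_mem_Ioc hm i hy.2).1.le).le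
  · intro i
    refine Measurable.aemeasurable ?_
    have h1 : Measurable (chanBranch m i) := by unfold chanBranch; fun_prop
    have h3 := measurable_chanRho (m := m)
    fun_prop

theorem chanGamma_univ {m : ℕ} (hm : 2 ≤ m) : chanGamma m univ = 1 := by
  have h2 := two_le_cast hm
  have hm1 : 0 < (m : ℝ) - 1 := by linarith
  let G : ℝ → ℝ := fun x => chanK m / ((m : ℝ) - 1) ^ 2 *
    (Real.log (((m : ℝ) - 1) * x + 1) - Real.log (((m : ℝ) - 1) * x + m))
  have hG : ∀ x ∈ uIcc (0 : ℝ) 1, HasDerivAt G (chanRho m x) x := by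
    intro x hx
    rw [uIcc_of_le zero_le_one] at hx
    have hx0 : 0 ≤ ((m : ℝ) - 1) * x := mul_nonneg hm1.le hx.1
    have hl (c : ℝ) : HasDerivAt (fun x => ((m : ℝ) - 1) * x + c) ((m : ℝ) - 1) x := by
      simpa using ((hasDerivAt_id x).const_mul ((m : ℝ) - 1)).add_const c
    refine ((((hl 1).log (by positivity)).sub ((hl m).log (by positivity))).const_mul
      (chanK m / ((m : ℝ) - 1) ^ 2)).congr_deriv ?_
    unfold chanRho
    field_simp
    ring
  have hcont : ContinuousOn (chanRho m) (Icc 0 1) := by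
    intro x hx
    have hx0 : 0 ≤ ((m : ℝ) - 1) * x := mul_nonneg hm1.le hx.1
    refine ContinuousAt.continuousWithinAt ?_
    unfold chanRho
    exact ContinuousAt.div (by fun_prop) (by fun_prop) (by positivity)
  have hint : IntervalIntegrable (chanRho m) volume 0 1 :=
    ContinuousOn.intervalIntegrable (by rwa [uIcc_of_le zero_le_one])
  have hval : ∫ x in (0 : ℝ)..1, chanRho m x = 1 := by
    rw [intervalIntegral.integral_eq_sub_of_hasDerivAt hG hint]
    have hl : Real.log ((m : ℝ) ^ 2 / (2 * m - 1)) = 2 * Real.log m - Real.log (2 * m - 1) := by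
      rw [Real.log_div (by positivity) (by linarith), Real.log_pow]
      norm_num
    have hne : Real.log ((m : ℝ) ^ 2 / (2 * m - 1)) ≠ 0 :=
      (Real.log_pos (by rw [one_lt_div (by linarith)]; nlinarith)).ne'
    simp only [G, chanK]
    rw [show ((m : ℝ) - 1) * 1 + 1 = m by ring, show ((m : ℝ) - 1) * 1 + m = 2 * m - 1 by ring,
      show ((m : ℝ) - 1) * 0 + 1 = 1 by ring, show ((m : ℝ) - 1) * 0 + m = m by ring,
      Real.log_one, ← mul_sub,
      show Real.log m - Real.log (2 * m - 1) - (0 - Real.log m)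
        = Real.log ((m : ℝ) ^ 2 / (2 * m - 1)) by rw [hl]; ring]
    generalize Real.log ((m : ℝ) ^ 2 / (2 * m - 1)) = L at hne
    field_simp
  rw [chanGamma_apply_Ioc MeasurableSet.univ, univ_inter, ← ofReal_integral_eq_lintegral_ofReal,
    ← intervalIntegral.integral_of_le zero_le_one, hval, ENNReal.ofReal_one]
  · exact (intervalIntegrable_iff_integrableOn_Ioc_of_le zero_le_one).1 hint
  · exact (ae_restrict_mem measurableSet_Ioc).mono fun x hx => (chanRho_pos hm hx.1.le).le

theorem ae_chanGamma_iff {m : ℕ} (hm : 2 ≤ m) {p : ℝ → Prop} :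
    (∀ᵐ x ∂chanGamma m, p x) ↔ ∀ᵐ x ∂volume.restrict (Icc (0 : ℝ) 1), p x := by
  have hmeas : Measurable fun x => ENNReal.ofReal (chanRho m x) :=
    measurable_chanRho.ennreal_ofReal
  rw [chanGamma, ae_withDensity_iff hmeas]
  refine Filter.eventually_congr ?_
  filter_upwards [ae_restrict_mem measurableSet_Icc] with x hx
  have := chanRho_pos hm hx.1
  simp [this]

/-- Almost every orbit of `τ_m` stays in the open unit interval. -/
theorem ae_iterate_chanTau_mem_Ioo {m : ℕ} (hm : 2 ≤ m) :
    ∀ᵐ x ∂volume.restrict (Icc (0 : ℝ) 1), ∀ n, (chanTau m)^[n] x ∈ Ioo (0 : ℝ) 1 := by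
  have h0 : ∀ᵐ x ∂chanGamma m, x ∈ Ioo (0 : ℝ) 1 := by
    rw [ae_chanGamma_iff hm, ← Measure.restrict_congr_set Ioo_ae_eq_Icc]
    exact ae_restrict_mem measurableSet_Ioo
  have hmp := measurePreserving_chanTau hm
  rw [ae_all_iff]
  intro n
  rw [← ae_chanGamma_iff hm]
  exact (hmp.iterate n).quasiMeasurePreserving.ae h0

/-- Compositions of inverse branches of `τ_m` have the form `y ↦ α + β y / (1 + s y)` with
`0 ≤ s ≤ m - 1`. -/
theorem exists_inverse_iterate {m : ℕ} (hm : 2 ≤ m) {A : Set ℝ}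
    (hA : {x ∈ Icc (0 : ℝ) 1 | chanTau m x ∈ A} = A)
    {x : ℝ} (hx : ∀ n, (chanTau m)^[n] x ∈ Ioo (0 : ℝ) 1) (n : ℕ) :
    ∃ α β s : ℝ, β ≠ 0 ∧ 0 ≤ s ∧ s ≤ m - 1 ∧ |β| / (1 + s) ≤ (((m : ℝ) - 1) / m) ^ n ∧
      (∀ y ∈ Ioo (0 : ℝ) 1, y ∈ A → α + β * y / (1 + s * y) ∈ A) ∧
      α + β * (chanTau m)^[n] x / (1 + s * (chanTau m)^[n] x) = x := by
  have h2 := two_le_cast hm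
  have hm1 : 0 < (m : ℝ) - 1 := by linarith
  induction n with
  | zero => exact ⟨0, 1, 0, by norm_num, le_rfl, hm1.le, by norm_num, by simp, by simp⟩
  | succ n ih =>
    obtain ⟨α, β, s, hβ, hs, hsm, hlen, hψ, hψx⟩ := ih
    obtain ⟨-, i, hi⟩ := exists_chanBranch_chanTau hm (Ioo_subset_Ioc_self (hx n))
    rw [← Function.iterate_succ_apply' (chanTau m)] at hi
    obtain ⟨t, ht⟩ : ∃ t, t = ((m : ℝ) ^ i)⁻¹ := ⟨_, rfl⟩
    have ht0 : 0 < t := by rw [ht]; positivity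
    have ht1 : t ≤ 1 := by rw [ht]; exact inv_le_one_of_one_le₀ (one_le_pow₀ (by linarith))
    have hst : 1 ≤ 1 + s * t := by nlinarith
    have hcomp : ∀ y, 0 < y → α + β * t / (1 + s * t) +
        -(β * t * (m - 1) / (1 + s * t) ^ 2) * y / (1 + (m - 1) / (1 + s * t) * y) =
        α + β * chanBranch m i y / (1 + s * chanBranch m i y) := by
      intro y hy
      have hay : 0 < ((m : ℝ) - 1) * y := by positivity
      have e1 : 1 + s * (t / (1 + ((m : ℝ) - 1) * y)) =
          (1 + s * t + (m - 1) * y) / (1 + (m - 1) * y) := by field_simp; ring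
      have e2 : 1 + ((m : ℝ) - 1) / (1 + s * t) * y =
          (1 + s * t + (m - 1) * y) / (1 + s * t) := by field_simp
      have h3 : 0 < 1 + s * t + (m - 1) * y := by positivity
      rw [chanBranch, ← ht, e1, e2]
      field_simp
      ring
    refine ⟨α + β * t / (1 + s * t), -(β * t * (m - 1) / (1 + s * t) ^ 2), (m - 1) / (1 + s * t),
      ?_, by positivity, div_le_self hm1.le hst, ?_, ?_, ?_⟩
    · exact neg_ne_zero.2 (by positivity)
    · rw [abs_neg, abs_div, abs_mul, abs_mul, abs_of_pos ht0, abs_of_pos hm1,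
        abs_of_pos (by positivity : 0 < (1 + s * t) ^ 2)]
      have e : |β| * t * (m - 1) / (1 + s * t) ^ 2 / (1 + (m - 1) / (1 + s * t)) =
          |β| / (1 + s) * ((m - 1) * ((1 + s) * t) / ((1 + s * t) * (1 + s * t + (m - 1)))) := by
        have : 1 + ((m : ℝ) - 1) / (1 + s * t) = (1 + s * t + (m - 1)) / (1 + s * t) := by
          field_simp
        rw [this]
        field_simp
      rw [e, pow_succ]
      refine mul_le_mul hlen ?_ (by positivity) (by positivity)
      rw [div_le_div_iff₀ (by positivity) (by positivity), mul_assoc]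
      refine mul_le_mul_of_nonneg_left ?_ hm1.le
      exact mul_le_mul (by linarith) (by nlinarith) (by positivity) (by positivity)
    · intro y hy hyA
      rw [hcomp y hy.1]
      have hb := chanBranch_mem_Ioo hm i hy
      refine hψ _ hb ?_
      rw [← hA]
      exact ⟨Ioo_subset_Icc_self hb, by rwa [chanTau_chanBranch hm i (Ioo_subset_Ico_self hy)]⟩
    · rw [hcomp _ (hx (n + 1)).1, hi, hψx]
theorem moebius_mem_closedBall {α β s y : ℝ} (hs : 0 ≤ s) (hy : y ∈ Icc (0 : ℝ) 1) :
    α + β * y / (1 + s * y) ∈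
      Metric.closedBall (α + β / (1 + s) / 2) (|β| / (1 + s) / 2) := by
  have h1 : 0 < 1 + s * y := by nlinarith [hy.1]
  have e : α + β * y / (1 + s * y) - (α + β / (1 + s) / 2) =
      β / (1 + s) * (y * (1 + s) / (1 + s * y) - 1 / 2) := by
    field_simp
    ring
  have h2 : 0 ≤ y * (1 + s) / (1 + s * y) := div_nonneg (by nlinarith [hy.1]) h1.le
  have h3 : y * (1 + s) / (1 + s * y) ≤ 1 := (div_le_one h1).2 (by nlinarith [hy.2])
  rw [mem_closedBall_iff_norm, Real.norm_eq_abs, e, abs_mul, abs_div,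
    abs_of_pos (by positivity : 0 < 1 + s), div_eq_mul_inv _ (2 : ℝ)]
  refine mul_le_mul_of_nonneg_left ?_ (by positivity)
  rw [abs_le]
  constructor <;> linarith

/-- Bounded distortion: the image of `A` under a Möbius map occupies at least the proportion
`|A| / (1 + s)` of the image of the unit interval. -/
theorem volume_inter_moebius_image {A : Set ℝ} (hA : MeasurableSet A) {α β s : ℝ} (hβ : β ≠ 0)
    (hs : 0 ≤ s) (hψ : ∀ y ∈ Ioo (0 : ℝ) 1, y ∈ A → α + β * y / (1 + s * y) ∈ A) :
    ENNReal.ofReal (|β| / (1 + s) ^ 2) * volume (A ∩ Ioo 0 1) ≤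
      volume (A ∩ Metric.closedBall (α + β / (1 + s) / 2) (|β| / (1 + s) / 2)) := by
  have hd : ∀ y ∈ A ∩ Ioo (0 : ℝ) 1, HasDerivWithinAt (fun y => α + β * y / (1 + s * y))
      (β / (1 + s * y) ^ 2) (A ∩ Ioo 0 1) y := by
    intro y hy
    have hy0 := hy.2.1
    have h1 : 1 + s * y ≠ 0 := by positivity
    refine HasDerivAt.hasDerivWithinAt ?_
    refine (((((hasDerivAt_id y).const_mul β).div
      (((hasDerivAt_id y).const_mul s).const_add 1) h1)).const_add α).congr_deriv ?_
    simp only [id]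
    field_simp
    ring
  have hinj : InjOn (fun y => α + β * y / (1 + s * y)) (A ∩ Ioo 0 1) := by
    intro y hy z hz h
    have hy0 := hy.2.1
    have hz0 := hz.2.1
    have h1 : 1 + s * y ≠ 0 := by positivity
    have h2 : 1 + s * z ≠ 0 := by positivity
    simp only [add_right_inj] at h
    rw [div_eq_div_iff h1 h2] at h
    exact mul_left_cancel₀ hβ (by linear_combination h)
  have hAI : MeasurableSet (A ∩ Ioo (0 : ℝ) 1) := hA.inter measurableSet_Ioo
  have hsub : (fun y => α + β * y / (1 + s * y)) '' (A ∩ Ioo 0 1) ⊆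
      A ∩ Metric.closedBall (α + β / (1 + s) / 2) (|β| / (1 + s) / 2) := by
    rintro _ ⟨y, ⟨hyA, hy⟩, rfl⟩
    exact ⟨hψ y hy hyA, moebius_mem_closedBall hs (Ioo_subset_Icc_self hy)⟩
  refine le_trans ?_ (measure_mono hsub)
  rw [← setLIntegral_one (_ '' _), lintegral_image_eq_lintegral_abs_deriv_mul hAI hd hinj,
    ← setLIntegral_const]
  refine setLIntegral_mono' hAI fun y hy => ?_
  have hy0 := hy.2.1
  have hy1 := hy.2.2
  rw [mul_one, abs_div, abs_of_pos (by positivity : 0 < (1 + s * y) ^ 2)]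
  gcongr
  nlinarith

theorem volume_eq_zero_or_volume_compl_eq_zero {m : ℕ} (hm : 2 ≤ m) {A : Set ℝ}
    (hAm : MeasurableSet A) (hA : {x ∈ Icc (0 : ℝ) 1 | chanTau m x ∈ A} = A) :
    volume (A ∩ Ioo 0 1) = 0 ∨ volume (Icc 0 1 \ A) = 0 := by
  have h2 := two_le_cast hm
  by_contra! h
  obtain ⟨hA0, hB0⟩ := h
  have hB : MeasurableSet (Icc (0 : ℝ) 1 \ A) := measurableSet_Icc.diff hAm
  have hae := IsUnifLocDoublingMeasure.ae_tendsto_measure_inter_div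
    (volume : Measure ℝ) (Icc 0 1 \ A) 1
  have horb := ae_restrict_of_ae_restrict_of_subset (sdiff_subset (t := A))
    (ae_iterate_chanTau_mem_Ioo hm)
  have : (ae (volume.restrict (Icc (0 : ℝ) 1 \ A))).NeBot := by
    rwa [ae_neBot, Ne, Measure.restrict_eq_zero]
  obtain ⟨x, hdens, hx⟩ := (hae.and horb).exists
  choose α β s hβ hs hsm hlen hψ hψx using exists_inverse_iterate hm hA hx
  have hδ : ∀ n, 0 < |β n| / (1 + s n) / 2 := fun n => by
    have := hs n
    have := abs_pos.2 (hβ n)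
    positivity
  have hlim : Filter.Tendsto (fun n => |β n| / (1 + s n) / 2) Filter.atTop
      (nhdsWithin 0 (Ioi 0)) := by
    refine tendsto_nhdsWithin_iff.2 ⟨?_, Filter.Eventually.of_forall hδ⟩
    have hr : Filter.Tendsto (fun n => (((m : ℝ) - 1) / m) ^ n) Filter.atTop (nhds 0) :=
      tendsto_pow_atTop_nhds_zero_of_lt_one (div_nonneg (by linarith) (by linarith))
        ((div_lt_one (by linarith)).2 (by linarith))
    exact squeeze_zero (fun n => (hδ n).le) (fun n => by linarith [hlen n, hδ n]) hr
  have key := hdens (fun n => α n + β n / (1 + s n) / 2) _ hlim (Filter.Eventually.of_forall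
    fun n => by
      rw [one_mul]
      simpa only [hψx n] using moebius_mem_closedBall (α := α n) (β := β n) (hs n)
        (Ioo_subset_Icc_self (hx n)))
  set c : ENNReal := ENNReal.ofReal (1 / m) * volume (A ∩ Ioo 0 1)
  have hc : c ≠ 0 := mul_ne_zero (by simp; omega) hA0
  have hbound : ∀ n, volume ((Icc 0 1 \ A) ∩
      Metric.closedBall (α n + β n / (1 + s n) / 2) (|β n| / (1 + s n) / 2)) /
      volume (Metric.closedBall (α n + β n / (1 + s n) / 2) (|β n| / (1 + s n) / 2)) ≤ 1 - c := by
    intro n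
    have hsn := hs n
    have hβn := abs_pos.2 (hβ n)
    set J := Metric.closedBall (α n + β n / (1 + s n) / 2) (|β n| / (1 + s n) / 2)
    have hJ : volume J = ENNReal.ofReal (|β n| / (1 + s n)) := by
      rw [Real.volume_closedBall]
      congr 1
      ring
    have hJ0 : volume J ≠ 0 := by
      rw [hJ]
      exact (ENNReal.ofReal_pos.2 (by positivity)).ne'
    have hJt : volume J ≠ ⊤ := by rw [hJ]; exact ENNReal.ofReal_ne_top
    have hcJ : c * volume J ≤ volume (A ∩ J) := by
      refine le_trans ?_ (volume_inter_moebius_image hAm (hβ n) hsn (hψ n))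
      rw [hJ, mul_right_comm, ← ENNReal.ofReal_mul (by positivity)]
      gcongr
      rw [one_div_mul_eq_div, div_div, sq]
      gcongr
      linarith [hsm n]
    rw [ENNReal.div_le_iff hJ0 hJt, ENNReal.sub_mul (fun _ _ => hJt), one_mul]
    refine ENNReal.le_sub_of_add_le_right
      (ne_top_of_le_ne_top (ne_top_of_le_ne_top hJt (measure_mono inter_subset_right)) hcJ) ?_
    calc _ ≤ volume (J \ A) + volume (J ∩ A) := by
          refine add_le_add (measure_mono fun y hy => ⟨hy.2, hy.1.2⟩) ?_
          rwa [inter_comm J A]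
      _ = volume J := measure_sdiff_add_inter J hAm
  have hle := le_of_tendsto key (Filter.Eventually.of_forall hbound)
  exact absurd hle (not_le.2 (ENNReal.sub_lt_self ENNReal.one_ne_top one_ne_zero hc))

/-- `τ_m` is ergodic with respect to the invariant probability measure `γ_m`:
it is measure preserving, and every Borel set `A ⊆ [0,1]` which is invariant
(`τ_m⁻¹(A) = A` as subsets of `[0,1]`) has `γ_m`-measure `0` or `1`. -/
theorem chanTau_ergodic (m : ℕ) (hm : 2 ≤ m) :
    MeasurePreserving (chanTau m) (chanGamma m) (chanGamma m) ∧
      ∀ A : Set ℝ, A ⊆ Set.Icc (0 : ℝ) 1 → MeasurableSet A →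
        {x ∈ Set.Icc (0 : ℝ) 1 | chanTau m x ∈ A} = A →
        chanGamma m A = 0 ∨ chanGamma m A = 1 := by
  refine ⟨measurePreserving_chanTau hm, fun A hAI hAm hA => ?_⟩
  have hsub : ∀ B : Set ℝ, volume (B ∩ Icc 0 1) = 0 → chanGamma m B = 0 := fun B hB => by
    refine withDensity_absolutelyContinuous _ _ ?_
    rwa [Measure.restrict_apply' measurableSet_Icc]
  rcases volume_eq_zero_or_volume_compl_eq_zero hm hAm hA with h | h
  · left
    apply hsub
    rwa [← measure_congr (Filter.EventuallyEq.rfl.inter Ioo_ae_eq_Icc)]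
  · right
    have hc : chanGamma m Aᶜ = 0 := hsub _ (by rwa [inter_comm, ← sdiff_eq])
    rw [← chanGamma_univ hm, ← measure_add_measure_compl hAm, hc, add_zero]
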